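/- (Voronoi) For each n ≥ 2 there are only finitely many equivalence classes of perfect forms modulo the action of SL(n,ℤ): there exists a finite set F of perfect positive definite real symmetric n×n matrices with μ(A) = 1 such that every perfect positive definite real symmetric n×n matrix A with μ(A) = 1 satisfies A = γᵀA₀γ for some A₀ ∈ F and some γ ∈ SL(n,ℤ). -/

import Mathlib

open Matrix
open scoped MatrixGroups

/-- The value `vᵀAv` of the quadratic form of a real matrix `A` at an integer vector. -/
noncomputable def qval (n : ℕ) (A : Matrix (Fin n) (Fin n) ℝ) (v : Fin n → ℤ) : ℝ :=
  (fun i => (v i : ℝ)) ⬝ᵥ A.mulVec fun i => (v i : ℝ)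

/-- An integer vector is primitive if the gcd of its coordinates is 1. -/
def IsPrimitiveVec {n : ℕ} (v : Fin n → ℤ) : Prop :=
  Finset.univ.gcd v = 1

/-- `μ(A)`: the minimum of `vᵀAv` over primitive integer vectors `v`. -/
noncomputable def muMin (n : ℕ) (A : Matrix (Fin n) (Fin n) ℝ) : ℝ :=
  sInf {r : ℝ | ∃ v : Fin n → ℤ, IsPrimitiveVec v ∧ qval n A v = r}

/-- `M(A)`: the set of primitive integer vectors attaining `μ(A)`. -/
def minVecs (n : ℕ) (A : Matrix (Fin n) (Fin n) ℝ) : Set (Fin n → ℤ) :=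
  {v | IsPrimitiveVec v ∧ qval n A v = muMin n A}

/-- `A` is perfect if the only symmetric matrix `Z` with `mᵀZm = μ(A)` for all
`m ∈ M(A)` is `Z = A`. -/
def IsPerfectForm (n : ℕ) (A : Matrix (Fin n) (Fin n) ℝ) : Prop :=
  ∀ Z : Matrix (Fin n) (Fin n) ℝ, Z.IsSymm →
    (∀ m ∈ minVecs n A, qval n Z m = muMin n A) → Z = A

/-- The real matrix of `γ ∈ SL(n,ℤ)`. -/
noncomputable def slR {n : ℕ} (γ : Matrix.SpecialLinearGroup (Fin n) ℤ) :
    Matrix (Fin n) (Fin n) ℝ :=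
  (γ : Matrix (Fin n) (Fin n) ℤ).map (Int.cast : ℤ → ℝ)

/-- Cast an integer vector to a real vector. -/
def castV {n : ℕ} (v : Fin n → ℤ) : Fin n → ℝ := fun i => (v i : ℝ)

/-- Cast an integer matrix to a real matrix. -/
def castM {n : ℕ} (B : Matrix (Fin n) (Fin n) ℤ) : Matrix (Fin n) (Fin n) ℝ :=
  B.map (Int.cast : ℤ → ℝ)

lemma castV_mulVec {n : ℕ} (B : Matrix (Fin n) (Fin n) ℤ) (v : Fin n → ℤ) :
    castV (B *ᵥ v) = castM B *ᵥ castV v := by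
  ext i
  simp [castV, castM, Matrix.mulVec, dotProduct]

lemma qval_eq (n : ℕ) (A : Matrix (Fin n) (Fin n) ℝ) (v : Fin n → ℤ) :
    qval n A v = castV v ⬝ᵥ A *ᵥ castV v := rfl

lemma posDef_nonneg {n : ℕ} {A : Matrix (Fin n) (Fin n) ℝ} (hA : A.PosDef) (x : Fin n → ℝ) :
    0 ≤ x ⬝ᵥ A *ᵥ x := by
  have := hA.posSemidef.dotProduct_mulVec_nonneg x
  simpa using this

lemma mu_bddBelow {n : ℕ} {A : Matrix (Fin n) (Fin n) ℝ} (hA : A.PosDef) :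
    BddBelow {r : ℝ | ∃ v : Fin n → ℤ, IsPrimitiveVec v ∧ qval n A v = r} := by
  refine ⟨0, ?_⟩
  rintro r ⟨v, -, rfl⟩
  exact posDef_nonneg hA _

/-- Every nonzero integer vector has value at least one when the minimum is one. -/
lemma one_le_qval {n : ℕ} (hn : 0 < n) {A : Matrix (Fin n) (Fin n) ℝ} (hA : A.PosDef)
    (hmu : muMin n A = 1) (z : Fin n → ℤ) (hz : z ≠ 0) : 1 ≤ qval n A z := by
  have : Nonempty (Fin n) := ⟨⟨0, hn⟩⟩
  obtain ⟨p, hp, hp1⟩ := Finset.extract_gcd z (Finset.univ_nonempty)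
  set g := Finset.univ.gcd z with hg
  have hg0 : g ≠ 0 := by
    intro h
    apply hz
    ext i
    rw [hp i (Finset.mem_univ i), h]; simp
  have h1 : 1 ≤ qval n A p := by
    rw [← hmu]
    exact csInf_le (mu_bddBelow hA) ⟨p, hp1, rfl⟩
  have hzp : castV z = (g : ℝ) • castV p := by
    ext i
    simp [castV, hp i (Finset.mem_univ i)]
  have h2 : qval n A z = (g : ℝ) ^ 2 * qval n A p := by
    rw [qval_eq, qval_eq, hzp, Matrix.mulVec_smul, dotProduct_smul, smul_dotProduct]
    simp; ring
  have h3 : (1 : ℝ) ≤ (g : ℝ) ^ 2 := by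
    have : (1 : ℤ) ≤ g ^ 2 := by
      have := sq_pos_of_ne_zero hg0
      omega
    exact_mod_cast this
  rw [h2]
  nlinarith

lemma symm_swap {n : ℕ} {A : Matrix (Fin n) (Fin n) ℝ} (hA : Aᵀ = A) (x y : Fin n → ℝ) :
    x ⬝ᵥ A *ᵥ y = y ⬝ᵥ A *ᵥ x := by
  rw [dotProduct_mulVec, ← mulVec_transpose, hA, dotProduct_comm]

lemma posDef_transpose {n : ℕ} {A : Matrix (Fin n) (Fin n) ℝ} (hA : A.PosDef) : Aᵀ = A := by
  have := hA.isHermitian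
  rwa [Matrix.IsHermitian, Matrix.conjTranspose_eq_transpose_of_trivial] at this

lemma abs_pair_le {n : ℕ} {A : Matrix (Fin n) (Fin n) ℝ} (hA : A.PosDef) (x y : Fin n → ℝ)
    (hx : x ⬝ᵥ A *ᵥ x = 1) (hy : y ⬝ᵥ A *ᵥ y = 1) : |x ⬝ᵥ A *ᵥ y| ≤ 1 := by
  have h1 := posDef_nonneg hA (x + y)
  have h2 := posDef_nonneg hA (x - y)
  have h3 := symm_swap (posDef_transpose hA) x y
  simp only [mulVec_add, mulVec_sub, dotProduct_add, add_dotProduct, dotProduct_sub,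
    sub_dotProduct] at h1 h2
  rw [abs_le]
  constructor <;> linarith

/-- A combination of minimal vectors with coefficients smaller than `1/n` has value below one. -/
lemma comb_lt_one {n : ℕ} (hn : 0 < n) {A : Matrix (Fin n) (Fin n) ℝ} (hA : A.PosDef)
    (V : Matrix (Fin n) (Fin n) ℝ) (hV : ∀ j, V.col j ⬝ᵥ A *ᵥ V.col j = 1)
    (y : Fin n → ℝ) (hy : ∀ i, |y i| < 1 / n) :
    (V *ᵥ y) ⬝ᵥ A *ᵥ (V *ᵥ y) < 1 := by
  have : Nonempty (Fin n) := ⟨⟨0, hn⟩⟩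
  have hVy : V *ᵥ y = ∑ j, y j • V.col j := by
    ext i
    simp [Matrix.mulVec, dotProduct, mul_comm]
  have hexp : (V *ᵥ y) ⬝ᵥ A *ᵥ (V *ᵥ y)
      = ∑ i, ∑ j, y i * (y j * (V.col i ⬝ᵥ A *ᵥ V.col j)) := by
    rw [hVy, mulVec_sum, sum_dotProduct]
    refine Finset.sum_congr rfl fun i _ => ?_
    rw [dotProduct_sum]
    refine Finset.sum_congr rfl fun j _ => ?_
    rw [mulVec_smul, dotProduct_smul, smul_dotProduct]
    simp only [smul_eq_mul]; ring
  have hle : (V *ᵥ y) ⬝ᵥ A *ᵥ (V *ᵥ y) ≤ (∑ i, |y i|) * (∑ j, |y j|) := by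
    rw [hexp, Finset.sum_mul_sum]
    refine Finset.sum_le_sum fun i _ => Finset.sum_le_sum fun j _ => ?_
    refine (le_abs_self _).trans ?_
    rw [abs_mul, abs_mul]
    have := abs_pair_le hA _ _ (hV i) (hV j)
    exact mul_le_mul_of_nonneg_left (mul_le_of_le_one_right (abs_nonneg _) this) (abs_nonneg _)
  have hs : ∑ i, |y i| < 1 := by
    calc ∑ i, |y i| < ∑ _i : Fin n, (1 / n : ℝ) :=
          Finset.sum_lt_sum_of_nonempty Finset.univ_nonempty fun i _ => hy i
      _ = 1 := by
          have : (n : ℝ) ≠ 0 := by exact_mod_cast hn.ne'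
          simp [this]
  have h0 : 0 ≤ ∑ i, |y i| := Finset.sum_nonneg fun i _ => abs_nonneg _
  nlinarith

lemma castM_det {n : ℕ} (B : Matrix (Fin n) (Fin n) ℤ) : (castM B).det = (B.det : ℝ) :=
  (Int.cast_det B).symm

lemma card_quot {n : ℕ} (B : Matrix (Fin n) (Fin n) ℤ) (hB : B.det ≠ 0) :
    Nat.card ((Fin n → ℤ) ⧸ LinearMap.range B.mulVecLin) = B.det.natAbs := by
  have hinj : Function.Injective B.mulVecLin := by
    rw [← LinearMap.ker_eq_bot, LinearMap.ker_eq_bot']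
    intro m hm
    exact Matrix.eq_zero_of_mulVec_eq_zero hB hm
  rw [← Submodule.natAbs_det_equiv _ (LinearEquiv.ofInjective B.mulVecLin hinj)]
  congr 1
  rw [← LinearMap.det_toLin' B]
  congr 1

/-- Determinants of systems of minimal vectors are bounded by `n ^ n`. -/
lemma det_bound {n : ℕ} (hn : 0 < n) {A : Matrix (Fin n) (Fin n) ℝ} (hA : A.PosDef)
    (hmu : muMin n A = 1) (B : Matrix (Fin n) (Fin n) ℤ) (hB : ∀ j, B.col j ∈ minVecs n A) :
    B.det.natAbs ≤ n ^ n := by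
  by_contra hlt
  push Not at hlt
  have hd : B.det ≠ 0 := by
    intro h
    simp [h] at hlt
  have hdR : IsUnit (castM B).det := by
    rw [castM_det]
    exact isUnit_iff_ne_zero.2 (by exact_mod_cast hd)
  have hnR : (0 : ℝ) < n := by exact_mod_cast hn
  have hcard := card_quot B hd
  let x : ((Fin n → ℤ) ⧸ LinearMap.range B.mulVecLin) → Fin n → ℝ :=
    fun q => (castM B)⁻¹ *ᵥ castV q.out
  have hfr : ∀ t : ℝ, 0 ≤ ⌊n * Int.fract t⌋ ∧ ⌊n * Int.fract t⌋ < n := by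
    intro t
    have h1 := Int.fract_nonneg t
    have h2 := Int.fract_lt_one t
    constructor
    · exact Int.floor_nonneg.2 (by positivity)
    · rw [Int.floor_lt]
      push_cast
      nlinarith
  let φ : ((Fin n → ℤ) ⧸ LinearMap.range B.mulVecLin) → Fin n → Fin n :=
    fun q i => ⟨⌊n * Int.fract (x q i)⌋.toNat, by have := hfr (x q i); omega⟩
  have hninj : ¬ Function.Injective φ := by
    intro hφ
    have := Nat.card_le_card_of_injective φ hφ
    rw [hcard] at this
    simp at this
    omega
  rw [Function.not_injective_iff] at hninj
  obtain ⟨q, q', hqq, hne⟩ := hninj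
  have hfl : ∀ i, ⌊n * Int.fract (x q i)⌋ = ⌊n * Int.fract (x q' i)⌋ := by
    intro i
    have h := congrArg Fin.val (congrFun hqq i)
    simp only [φ] at h
    have h1 := hfr (x q i)
    have h2 := hfr (x q' i)
    omega
  let u : Fin n → ℤ := fun i => ⌊x q i⌋ - ⌊x q' i⌋
  let y : Fin n → ℝ := fun i => Int.fract (x q i) - Int.fract (x q' i)
  let z : Fin n → ℤ := q.out - q'.out - B *ᵥ u
  have hy : ∀ i, |y i| < 1 / n := by
    intro i
    have := Int.abs_sub_lt_one_of_floor_eq_floor (hfl i)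
    rw [← mul_sub, abs_mul, abs_of_pos hnR] at this
    rw [lt_div_iff₀ hnR, mul_comm]
    exact this
  have hx : ∀ p, castM B *ᵥ x p = castV p.out := by
    intro p
    simp only [x]
    rw [mulVec_mulVec, Matrix.mul_nonsing_inv _ hdR, one_mulVec]
  have hyx : y = x q - x q' - castV u := by
    ext i
    simp only [y, u, castV, Pi.sub_apply, Int.fract]
    push_cast
    ring
  have hzy : castV z = castM B *ᵥ y := by
    rw [hyx, mulVec_sub, mulVec_sub, hx, hx, ← castV_mulVec]
    ext i
    simp [z, castV]
  have hz : z ≠ 0 := by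
    intro h0
    apply hne
    rw [← Quotient.out_eq q, ← Quotient.out_eq q']
    refine (Submodule.Quotient.eq _).2 ?_
    refine ⟨u, ?_⟩
    rw [Matrix.mulVecLin_apply]
    exact (sub_eq_zero.1 h0).symm
  have h1 := one_le_qval hn hA hmu z hz
  rw [qval_eq, hzy] at h1
  have h2 := comb_lt_one hn hA (castM B) (fun j => by
    have := (hB j).2
    rw [hmu] at this
    exact this) y hy
  linarith

/-- A perfect form has `n` independent minimal vectors. -/
lemma exists_basis {n : ℕ} {A : Matrix (Fin n) (Fin n) ℝ} (hA : A.PosDef)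
    (hP : IsPerfectForm n A) :
    ∃ B : Matrix (Fin n) (Fin n) ℤ, (∀ j, B.col j ∈ minVecs n A) ∧ B.det ≠ 0 := by
  have htop : ⊤ ≤ Submodule.span ℝ (castV '' minVecs n A) := by
    by_contra hnt
    obtain ⟨f, hf0, hf⟩ := Submodule.exists_le_ker_of_lt_top _ (lt_top_iff_ne_top.2
      (fun h => hnt h.ge))
    let w : Fin n → ℝ := fun i => f (Pi.single i 1)
    have hfw : ∀ v, f v = w ⬝ᵥ v := by
      intro v
      rw [LinearMap.pi_apply_eq_sum_univ f v]
      simp only [dotProduct, w, smul_eq_mul]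
      refine Finset.sum_congr rfl fun i _ => ?_
      rw [mul_comm]
      congr 2
      ext j
      simp [Pi.single_apply, eq_comm]
    have hZ := hP (A + vecMulVec w w) ?_ ?_
    · apply hf0
      have h0 : vecMulVec w w = 0 := by simpa using hZ
      have hw : ∀ i, w i = 0 := by
        intro i
        have := congrFun (congrFun h0 i) i
        simpa [vecMulVec_apply] using this
      ext i
      simpa [w] using hw i
    · rw [Matrix.IsSymm, transpose_add, posDef_transpose hA, transpose_vecMulVec]
    · intro m hm
      have h0 : w ⬝ᵥ castV m = 0 := by
        rw [← hfw]
        exact hf (Submodule.subset_span ⟨m, hm, rfl⟩)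
      rw [qval_eq, add_mulVec, dotProduct_add, ← qval_eq, hm.2, vecMulVec_mulVec, h0]
      simp
  let b := Module.Basis.ofSpan htop
  have hb : ∀ i, b i ∈ castV '' minVecs n A := fun i =>
    Module.Basis.ofSpan_subset htop ⟨i, rfl⟩
  let e := b.indexEquiv (Pi.basisFun ℝ (Fin n))
  choose v hv hvb using hb
  let B : Matrix (Fin n) (Fin n) ℤ := Matrix.of fun i j => v (e.symm j) i
  refine ⟨B, fun j => hv _, ?_⟩
  have hli : LinearIndependent ℝ (castM B).col := by
    have h1 : (castM B).col = b ∘ e.symm := by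
      ext j i
      exact congrFun (hvb (e.symm j)) i
    rw [h1]
    exact b.linearIndependent.comp _ e.symm.injective
  rw [Matrix.linearIndependent_cols_iff_isUnit, Matrix.isUnit_iff_isUnit_det, castM_det,
    isUnit_iff_ne_zero] at hli
  exact_mod_cast hli

/-- Two integer matrices of the same determinant `d ≠ 0`, congruent modulo `d`,
differ by an element of `SL(n,ℤ)`. -/
lemma exists_sl {n : ℕ} (B B' : Matrix (Fin n) (Fin n) ℤ) (hd : B.det ≠ 0)
    (hdd : B'.det = B.det) (hmod : ∀ i j, B' i j % B.det = B i j % B.det) :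
    ∃ γ : Matrix.SpecialLinearGroup (Fin n) ℤ, (γ : Matrix (Fin n) (Fin n) ℤ) * B = B' := by
  have hk : ∀ i j, ∃ k, B' i j - B i j = B.det * k := fun i j =>
    Int.ModEq.dvd (hmod i j).symm
  choose K hK using hk
  have hmul : (1 + Matrix.of K * B.adjugate) * B = B' := by
    rw [add_mul, one_mul, mul_assoc, adjugate_mul]
    ext i j
    have := hK i j
    rw [Matrix.mul_smul, Matrix.mul_one, Matrix.add_apply, Matrix.smul_apply, Matrix.of_apply,
      smul_eq_mul]
    linarith
  refine ⟨⟨1 + Matrix.of K * B.adjugate, ?_⟩, hmul⟩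
  have := congrArg Matrix.det hmul
  rw [det_mul, hdd] at this
  exact mul_right_cancel₀ hd (by rw [this, one_mul])

/-- Entries of `adj(B) v` are bounded for minimal vectors `v`. -/
lemma adj_bound {n : ℕ} (hn : 0 < n) {A : Matrix (Fin n) (Fin n) ℝ} (hA : A.PosDef)
    (hmu : muMin n A = 1) (B : Matrix (Fin n) (Fin n) ℤ) (hB : ∀ j, B.col j ∈ minVecs n A)
    (v : Fin n → ℤ) (hv : v ∈ minVecs n A) (i : Fin n) :
    ((B.adjugate *ᵥ v) i).natAbs ≤ n ^ n := by
  rw [← cramer_eq_adjugate_mulVec, cramer_apply]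
  refine det_bound hn hA hmu _ fun j => ?_
  by_cases hj : j = i
  · subst hj
    have : (B.updateCol j v).col j = v := by ext k; simp
    rwa [this]
  · have : (B.updateCol i v).col j = B.col j := by ext k; simp [hj]
    rw [this]; exact hB j

/-- The finite invariant of a perfect form with a chosen system of minimal vectors. -/
def invt {n : ℕ} (A : Matrix (Fin n) (Fin n) ℝ) (B : Matrix (Fin n) (Fin n) ℤ) :
    ℤ × (Fin n → Fin n → ℤ) × Set (Fin n → ℤ) :=
  (B.det, fun i j => B i j % B.det, (fun v => B.adjugate *ᵥ v) '' minVecs n A)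

lemma equiv_of_invt {n : ℕ} {A A' : Matrix (Fin n) (Fin n) ℝ} (hA' : A'.PosDef)
    (hP : IsPerfectForm n A) (hmu : muMin n A = 1) (hmu' : muMin n A' = 1)
    (B B' : Matrix (Fin n) (Fin n) ℤ) (hd : B.det ≠ 0) (h : invt A' B' = invt A B) :
    ∃ γ : Matrix.SpecialLinearGroup (Fin n) ℤ, A = (slR γ)ᵀ * A' * slR γ := by
  simp only [invt, Prod.mk.injEq] at h
  obtain ⟨h1, h2, h3⟩ := h
  rw [h1] at h2
  obtain ⟨γ, hγ⟩ := exists_sl B B' hd h1 (fun i j => congrFun (congrFun h2 i) j)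
  refine ⟨γ, (hP _ ?_ ?_).symm⟩
  · rw [Matrix.IsSymm]
    simp only [transpose_mul, transpose_transpose, posDef_transpose hA', Matrix.mul_assoc]
  · intro m hm
    have hm' : B.adjugate *ᵥ m ∈ (fun v => B'.adjugate *ᵥ v) '' minVecs n A' := by
      rw [h3]; exact ⟨m, hm, rfl⟩
    obtain ⟨m', hm', he⟩ := hm'
    have he2 : B' *ᵥ (B'.adjugate *ᵥ m') = B' *ᵥ (B.adjugate *ᵥ m) := congrArg _ he
    rw [mulVec_mulVec, mul_adjugate, ← hγ, mulVec_mulVec, Matrix.mul_assoc, mul_adjugate, hγ, h1]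
      at he2
    have he3 : m' = (γ : Matrix (Fin n) (Fin n) ℤ) *ᵥ m := by
      simp only [smul_mulVec, one_mulVec, Matrix.mul_smul, Matrix.mul_one] at he2
      exact smul_right_injective _ hd he2
    have h4 := hm'.2
    rw [hmu', he3, qval_eq, castV_mulVec] at h4
    rw [hmu, qval_eq, ← h4]
    change _ = (slR γ *ᵥ castV m) ⬝ᵥ A' *ᵥ slR γ *ᵥ castV m
    rw [← mulVec_mulVec, ← mulVec_mulVec, dotProduct_mulVec, vecMul_transpose]

/-- (Voronoi) For each `n ≥ 2` there are only finitely many perfect forms modulo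
`SL(n,ℤ)`: there is a finite set `F` of perfect positive definite symmetric matrices
with `μ = 1` such that every perfect positive definite `A` with `μ(A) = 1` is
`SL(n,ℤ)`-equivalent to a member of `F`. -/
theorem stmt_13 (n : ℕ) (hn : 2 ≤ n) :
    ∃ F : Set (Matrix (Fin n) (Fin n) ℝ), F.Finite ∧
      (∀ A₀ ∈ F, A₀.PosDef ∧ IsPerfectForm n A₀ ∧ muMin n A₀ = 1) ∧
      (∀ A : Matrix (Fin n) (Fin n) ℝ, A.PosDef → IsPerfectForm n A → muMin n A = 1 →
        ∃ A₀ ∈ F, ∃ γ : Matrix.SpecialLinearGroup (Fin n) ℤ,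
          A = (slR γ)ᵀ * A₀ * slR γ) := by
  have hn0 : 0 < n := by omega
  let S : Set (Matrix (Fin n) (Fin n) ℝ) :=
    {A | A.PosDef ∧ IsPerfectForm n A ∧ muMin n A = 1}
  have hS : ∀ A, A ∈ S → ∃ B : Matrix (Fin n) (Fin n) ℤ,
      (∀ j, B.col j ∈ minVecs n A) ∧ B.det ≠ 0 := fun A hA => exists_basis hA.1 hA.2.1
  choose! B hB hBd using hS
  let f := fun A => invt A (B A)
  have hfin : (f '' S).Finite := by
    let N : ℤ := (n : ℤ) ^ n
    refine Set.Finite.subset (s := Set.Icc (-N) N ×ˢ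
      (Set.Icc (fun _ _ => 0) (fun _ _ => N) ×ˢ
        𝒫 (Set.Icc (fun _ => -N) (fun _ => N)))) ?_ ?_
    · exact (Set.finite_Icc _ _).prod ((Set.finite_Icc _ _).prod (Set.finite_Icc _ _).finite_subsets)
    · rintro _ ⟨A, hA, rfl⟩
      have hdb : |(B A).det| ≤ N := by
        have := det_bound hn0 hA.1 hA.2.2 (B A) (hB A hA)
        simp only [N]
        zify at this
        exact this
      refine ⟨abs_le.1 hdb, ⟨?_, ?_⟩, ?_⟩
      · intro i j
        exact Int.emod_nonneg _ (hBd A hA)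
      · intro i j
        exact (Int.emod_lt_abs _ (hBd A hA)).le.trans hdb
      · rintro _ ⟨v, hv, rfl⟩
        have : ∀ i, |((B A).adjugate *ᵥ v) i| ≤ N := by
          intro i
          have := adj_bound hn0 hA.1 hA.2.2 (B A) (hB A hA) v hv i
          simp only [N]
          zify at this
          exact this
        exact ⟨fun i => (abs_le.1 (this i)).1, fun i => (abs_le.1 (this i)).2⟩
  obtain ⟨F, hFS, hF⟩ := Set.SurjOn.exists_bijOn_subset (Set.surjOn_image f S)
  refine ⟨F, hF.finite_iff_finite.2 hfin, fun A₀ h => hFS h, ?_⟩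
  intro A h1 h2 h3
  have hA : A ∈ S := ⟨h1, h2, h3⟩
  obtain ⟨A₀, hA₀, he⟩ := hF.surjOn ⟨A, hA, rfl⟩
  have hA₀S := hFS hA₀
  exact ⟨A₀, hA₀, equiv_of_invt hA₀S.1 h2 h3 hA₀S.2.2 (B A) (B A₀) (hBd A hA) he⟩
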